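/- Let V : [0,1) × ℝ → ℝ be a C¹ function with V(0,ℓ) = ℓ, cos(V(e,ℓ)) = C(e,ℓ) and sin(V(e,ℓ)) = S(e,ℓ) for all (e,ℓ). Then for every e ∈ [0,1) and ℓ ∈ ℝ, ∂V/∂e (e,ℓ) = sin(V(e,ℓ))·(2 + e·cos(V(e,ℓ)))/(1 − e²), the derivative being taken at fixed mean anomaly ℓ. -/

import Mathlib

/-- `C(e,ℓ) = (cos(u(e,ℓ)) − e)/(1 − e·cos(u(e,ℓ)))`, the cosine of the true anomaly. -/
noncomputable def Cfun (U : ℝ → ℝ → ℝ) (e ℓ : ℝ) : ℝ :=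
  (Real.cos (U e ℓ) - e) / (1 - e * Real.cos (U e ℓ))

/-- `S(e,ℓ) = √(1−e²)·sin(u(e,ℓ))/(1 − e·cos(u(e,ℓ)))`, the sine of the true anomaly. -/
noncomputable def Sfun (U : ℝ → ℝ → ℝ) (e ℓ : ℝ) : ℝ :=
  Real.sqrt (1 - e ^ 2) * Real.sin (U e ℓ) / (1 - e * Real.cos (U e ℓ))

/-- If `V : [0,1) × ℝ → ℝ` is a `C¹` branch of the true anomaly
(`V(0,ℓ) = ℓ`, `cos V = C`, `sin V = S`), then for every `e ∈ [0,1)` and `ℓ ∈ ℝ`,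
`∂V/∂e (e,ℓ) = sin(V(e,ℓ))·(2 + e·cos(V(e,ℓ)))/(1 − e²)`, the derivative in `e`
being taken at fixed mean anomaly `ℓ` (within `[0,1)`). -/
theorem stmt_6 (U : ℝ → ℝ → ℝ)
    (hU : ∀ e ∈ Set.Ico (0:ℝ) 1, ∀ ℓ : ℝ, U e ℓ - e * Real.sin (U e ℓ) = ℓ)
    (V : ℝ → ℝ → ℝ)
    (hV : ContDiffOn ℝ 1 (fun p : ℝ × ℝ => V p.1 p.2)
      (Set.Ico (0:ℝ) 1 ×ˢ (Set.univ : Set ℝ)))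
    (hV0 : ∀ ℓ : ℝ, V 0 ℓ = ℓ)
    (hVcs : ∀ e ∈ Set.Ico (0:ℝ) 1, ∀ ℓ : ℝ,
      Real.cos (V e ℓ) = Cfun U e ℓ ∧ Real.sin (V e ℓ) = Sfun U e ℓ) :
    ∀ e ∈ Set.Ico (0:ℝ) 1, ∀ ℓ : ℝ,
      HasDerivWithinAt (fun e' : ℝ => V e' ℓ)
        (Real.sin (V e ℓ) * (2 + e * Real.cos (V e ℓ)) / (1 - e ^ 2))
        (Set.Ico (0:ℝ) 1) e := by
  intro e he ℓ
  have hD : ∀ x ∈ Set.Ico (0:ℝ) 1, ∀ y : ℝ, 0 < 1 - x * Real.cos y := by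
    intro x hx y
    nlinarith [Real.cos_le_one y, hx.1, hx.2]
  have hD' : ∀ x ∈ Set.Ico (0:ℝ) 1, ∀ y : ℝ, 0 < 1 + x * Real.cos y := by
    intro x hx y
    nlinarith [Real.neg_one_le_cos y, hx.1, hx.2]
  have hpos : ∀ x ∈ Set.Ico (0:ℝ) 1, 0 < 1 - x ^ 2 := by
    intro x hx
    nlinarith [hx.1, hx.2]
  -- `V` is differentiable in `e`
  have hVd : DifferentiableWithinAt ℝ (fun x : ℝ => V x ℓ) (Set.Ico (0:ℝ) 1) e := by
    have h1 := (hV.differentiableOn (by norm_num)) (e, ℓ) ⟨he, Set.mem_univ _⟩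
    have h2 : DifferentiableWithinAt ℝ (fun x : ℝ => (x, ℓ)) (Set.Ico (0:ℝ) 1) e := by
      fun_prop
    exact DifferentiableWithinAt.comp (g := fun p : ℝ × ℝ => V p.1 p.2)
      (f := fun x : ℝ => (x, ℓ)) e h1 h2 (fun x hx => ⟨hx, Set.mem_univ _⟩)
  -- `U` is a smooth expression in `e` and `V`
  have hUeq : ∀ x ∈ Set.Ico (0:ℝ) 1,
      U x ℓ = ℓ + x * (Real.sqrt (1 - x ^ 2) * Real.sin (V x ℓ) / (1 + x * Real.cos (V x ℓ))) := by
    intro x hx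
    obtain ⟨hc, hs⟩ := hVcs x hx ℓ
    have hk := hU x hx ℓ
    have hq : Real.sqrt (1 - x ^ 2) ^ 2 = 1 - x ^ 2 := Real.sq_sqrt (hpos x hx).le
    have d1 := hD x hx (U x ℓ)
    have d2 := hD' x hx (V x ℓ)
    have hc' : Real.cos (V x ℓ) * (1 - x * Real.cos (U x ℓ)) = Real.cos (U x ℓ) - x := by
      rw [hc, Cfun, div_mul_cancel₀ _ d1.ne']
    have hs' : Real.sin (V x ℓ) * (1 - x * Real.cos (U x ℓ))
        = Real.sqrt (1 - x ^ 2) * Real.sin (U x ℓ) := by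
      rw [hs, Sfun, div_mul_cancel₀ _ d1.ne']
    have key : Real.sin (U x ℓ)
        = Real.sqrt (1 - x ^ 2) * Real.sin (V x ℓ) / (1 + x * Real.cos (V x ℓ)) := by
      rw [eq_div_iff d2.ne']
      apply mul_right_cancel₀ d1.ne'
      linear_combination x * Real.sin (U x ℓ) * hc' - Real.sqrt (1 - x ^ 2) * hs'
        - Real.sin (U x ℓ) * hq
    rw [← key]; linarith
  have hqd : HasDerivWithinAt (fun x : ℝ => Real.sqrt (1 - x ^ 2))
      (-(2 * e) / (2 * Real.sqrt (1 - e ^ 2))) (Set.Ico (0:ℝ) 1) e := by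
    have h := ((hasDerivAt_pow 2 e).const_sub 1).sqrt (hpos e he).ne'
    have h' : -(2 * e) / (2 * Real.sqrt (1 - e ^ 2))
        = -(((2 : ℕ) : ℝ) * e ^ (2 - 1)) / (2 * Real.sqrt (1 - e ^ 2)) := by norm_num
    rw [h']
    exact h.hasDerivWithinAt
  have hid := hasDerivWithinAt_id e (Set.Ico (0:ℝ) 1)
  have hUd : DifferentiableWithinAt ℝ (fun x : ℝ => U x ℓ) (Set.Ico (0:ℝ) 1) e := by
    refine DifferentiableWithinAt.congr ?_ hUeq (hUeq e he)
    exact (differentiableWithinAt_id.mul ((hqd.differentiableWithinAt.mul hVd.sin).div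
      ((differentiableWithinAt_id.mul hVd.cos).const_add 1) (hD' e he _).ne')).const_add ℓ
  have huniq : UniqueDiffWithinAt ℝ (Set.Ico (0:ℝ) 1) e := uniqueDiffOn_Ico 0 1 e he
  obtain ⟨hc, hs⟩ := hVcs e he ℓ
  have hVh := hVd.hasDerivWithinAt
  have hUh := hUd.hasDerivWithinAt
  generalize derivWithin (fun x : ℝ => V x ℓ) (Set.Ico (0:ℝ) 1) e = v at hVh
  generalize derivWithin (fun x : ℝ => U x ℓ) (Set.Ico (0:ℝ) 1) e = w at hUh
  have d1 := hD e he (U e ℓ)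
  have e0 := huniq.eq_deriv _ ((hUh.sub (hid.mul hUh.sin)).congr
    (fun x hx => (hU x hx ℓ).symm) (hU e he ℓ).symm) (hasDerivWithinAt_const e _ ℓ)
  have hDd := (hid.mul hUh.cos).const_sub 1
  have e1 := huniq.eq_deriv _ hVh.cos (((hUh.cos.sub hid).div hDd d1.ne').congr
    (fun x hx => (hVcs x hx ℓ).1) hc)
  have e2 := huniq.eq_deriv _ hVh.sin (((hqd.mul hUh.sin).div hDd d1.ne').congr
    (fun x hx => (hVcs x hx ℓ).2) hs)
  have hq : Real.sqrt (1 - e ^ 2) ^ 2 = 1 - e ^ 2 := Real.sq_sqrt (hpos e he).le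
  have hq0 : 0 < Real.sqrt (1 - e ^ 2) := Real.sqrt_pos.2 (hpos e he)
  suffices hh : Real.sin (V e ℓ) * (2 + e * Real.cos (V e ℓ)) / (1 - e ^ 2) = v by
    rw [hh]; exact hVh
  have hv : v = Real.cos (V e ℓ) * (Real.cos (V e ℓ) * v)
      - Real.sin (V e ℓ) * (-Real.sin (V e ℓ) * v) := by
    linear_combination -v * Real.sin_sq_add_cos_sq (V e ℓ)
  rw [e1, e2, hc, hs, Cfun, Sfun] at hv
  rw [hc, hs, Cfun, Sfun]
  simp only [id, Pi.mul_apply, Pi.sub_apply] at e0 hv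
  have hsc := Real.sin_sq_add_cos_sq (U e ℓ)
  generalize Real.cos (U e ℓ) = c at *
  generalize Real.sin (U e ℓ) = s at *
  rw [← hq]
  have hw : w = s / (1 - e * c) := by
    rw [eq_div_iff d1.ne']; linarith
  rw [hv, hw]
  generalize Real.sqrt (1 - e ^ 2) = q at *
  have d1' := d1.ne'
  field_simp
  have hs2 : s ^ 2 = 1 - c ^ 2 := by linarith
  rw [Real.sqrt_sq hq0.le, hs2, hq]
  ring
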